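/- arXiv:2304.00391 — 4 statements merged into one kernel-verified Lean document; each statement's English description precedes it below -/
import Mathlib

section
/- Let G be a simple undirected graph on a finite vertex set V with |V| = n ≥ 1, and let α ∈ [0,1]. If every connected component of G has strictly fewer than (1−α)·n vertices, then there exists a partition of V into two disjoint sets V₀ and V₁ with V₀ ∪ V₁ = V such that no edge of G joins a vertex of V₀ to a vertex of V₁, and (α/2)·n ≤ |V₀| ≤ |V₁| ≤ (1 − α/2)·n. -/
/-- If every weight is at most the length of the interval `[L, U]`, then a finite sum that reaches
`L` has a subsum lying in `[L, U]`. -/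
theorem Finset.exists_subset_sum_mem_Icc {ι : Type*} (w : ι → ℝ) {L U : ℝ} (hU : 0 ≤ U)
    (hw : ∀ i, w i ≤ U - L) (s : Finset ι) (hs : L ≤ ∑ i ∈ s, w i) :
    ∃ t ⊆ s, ∑ i ∈ t, w i ∈ Set.Icc L U := by
  classical
  induction s using Finset.induction_on with
  | empty => exact ⟨∅, subset_rfl, hs, by simpa using hU⟩
  | insert a s ha ih =>
    by_cases h : L ≤ ∑ i ∈ s, w i
    · obtain ⟨t, hts, ht⟩ := ih h
      exact ⟨t, hts.trans (Finset.subset_insert a s), ht⟩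
    · refine ⟨insert a s, subset_rfl, hs, ?_⟩
      rw [Finset.sum_insert ha]
      linarith [hw a]

/-- **Small components yield a balanced disconnected bipartition.** If every connected
component of a simple graph `G` on `n ≥ 1` vertices has strictly fewer than `(1-α)·n`
vertices, then the vertex set can be partitioned into two sets `V₀, V₁` with no edge
between them and `(α/2)·n ≤ |V₀| ≤ |V₁| ≤ (1 - α/2)·n`. -/
theorem exists_balanced_disconnected_bipartition
    {V : Type*} [Fintype V] [DecidableEq V] (G : SimpleGraph V)
    (n : ℕ) (hn : n = Fintype.card V) (hn1 : 1 ≤ n)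
    (α : ℝ) (hα0 : 0 ≤ α) (hα1 : α ≤ 1)
    (hcomp : ∀ c : G.ConnectedComponent,
      (Nat.card {v : V | G.connectedComponentMk v = c} : ℝ) < (1 - α) * n) :
    ∃ V₀ V₁ : Finset V, Disjoint V₀ V₁ ∧ V₀ ∪ V₁ = Finset.univ ∧
      (∀ x ∈ V₀, ∀ y ∈ V₁, ¬ G.Adj x y) ∧
      α / 2 * n ≤ (V₀.card : ℝ) ∧ V₀.card ≤ V₁.card ∧ (V₁.card : ℝ) ≤ (1 - α / 2) * n := by
  classical
  let w : G.ConnectedComponent → ℝ := fun c =>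
    ({v : V | G.connectedComponentMk v = c} : Finset V).card
  have hw : ∀ c, w c ≤ (1 - α / 2) * n - α / 2 * n := fun c => by
    have h := hcomp c
    rw [Nat.card_coe_set_eq, Set.ncard_eq_toFinset_card', Set.toFinset_ofPred] at h
    simp only [w]
    linarith
  have hsum (t : Finset G.ConnectedComponent) :
      ∑ c ∈ t, w c = ({v : V | G.connectedComponentMk v ∈ t} : Finset V).card := by
    rw [Finset.card_eq_sum_card_fiberwise (f := G.connectedComponentMk) (t := t)
      (fun v hv => by simpa using hv), Nat.cast_sum]
    refine Finset.sum_congr rfl fun c hc => ?_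
    rw [Finset.filter_filter]
    refine congrArg (fun B : Finset V => (B.card : ℝ)) (Finset.ext fun v => ?_)
    simp only [Finset.mem_filter_univ]
    exact ⟨fun h => ⟨h ▸ hc, h⟩, And.right⟩
  have hn0 : (1 : ℝ) ≤ n := by exact_mod_cast hn1
  obtain ⟨t, -, hL, hU⟩ := Finset.exists_subset_sum_mem_Icc w
    (L := α / 2 * n) (U := (1 - α / 2) * n) (by nlinarith) hw Finset.univ (by
      rw [hsum]
      simp only [Finset.mem_univ, Finset.filter_true, Finset.card_univ, ← hn]
      nlinarith)
  rw [hsum] at hL hU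
  set A : Finset V := {v : V | G.connectedComponentMk v ∈ t} with hA
  have hadj {x y : V} (h : G.Adj x y) : x ∈ A ↔ y ∈ A := by
    simp only [hA, Finset.mem_filter_univ, SimpleGraph.ConnectedComponent.sound h.reachable]
  have hcard : (A.card : ℝ) + Aᶜ.card = n := by
    rw [hn]
    exact_mod_cast Finset.card_add_card_compl A
  rcases le_total A.card Aᶜ.card with h | h
  · refine ⟨A, Aᶜ, disjoint_compl_right, Finset.union_compl A, fun x hx y hy hxy => ?_,
      hL, h, by linarith⟩
    exact Finset.mem_compl.mp hy ((hadj hxy).mp hx)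
  · refine ⟨Aᶜ, A, disjoint_compl_left, (Finset.union_comm _ _).trans (Finset.union_compl A),
      fun x hx y hy hxy => ?_, by linarith, h, hU⟩
    exact Finset.mem_compl.mp hx ((hadj hxy).mpr hy)
end

section
/- Let X, Y, Z be finite nonempty sets, let f : X × Y → Z be a function, let μ be a probability distribution on X × Y, and let 0 < ε < 1/2. Then there exist a real number α ≥ 0 and a function β : X × Y → ℝ with β(x,y) ≥ 0 for all (x,y), such that: (i) for every combinatorial rectangle R = S × T with S ⊆ X, T ⊆ Y, and every z ∈ Z, α·μ(R ∩ f⁻¹(z)) − Σ_{(x,y)∈R} β(x,y) ≤ 1; (ii) for every (x,y) ∈ X × Y, α·μ({(x,y)}) − β(x,y) ≥ 0; and (iii) (1−ε)·α − Σ_{(x,y)∈X×Y} β(x,y) ≥ ξ^μ_ε(f) − 1. In other words, the weak partition bound wprt^μ_ε(f) is at least ξ^μ_ε(f) − 1. -/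
/-- In a finite type, for every `j` below its cardinality, there are `j` elements of largest weight,
together with a next heaviest element. -/
theorem exists_heaviest_finset_and_next {Z : Type*} [Fintype Z] [DecidableEq Z] (m : Z → ℝ)
    (j : ℕ) (hj : j < Fintype.card Z) :
    ∃ (H : Finset Z) (w : Z), H.card = j ∧ w ∉ H ∧ (∀ z ∈ H, m w ≤ m z) ∧
      ∀ z ∉ H, m z ≤ m w := by
  have next (H : Finset Z) (hH : H.card < Fintype.card Z) :
      ∃ w ∉ H, ∀ z ∉ H, m z ≤ m w := by
    have hne : Hᶜ.Nonempty := by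
      rw [← Finset.card_pos, Finset.card_compl]
      omega
    obtain ⟨w, hw, hmax⟩ := Hᶜ.exists_max_image m hne
    exact ⟨w, Finset.mem_compl.1 hw, fun z hz => hmax z (Finset.mem_compl.2 hz)⟩
  induction j with
  | zero =>
    obtain ⟨w, hw, hmax⟩ := next ∅ (by simpa using hj)
    exact ⟨∅, w, rfl, hw, by simp, hmax⟩
  | succ j ih =>
    obtain ⟨H, w, hcard, hw, hge, hle⟩ := ih (by omega)
    have hcard' : (insert w H).card = j + 1 := by rw [Finset.card_insert_of_notMem hw, hcard]
    obtain ⟨v, hv, hmax⟩ := next (insert w H) (by omega)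
    have hvw : m v ≤ m w := hle v fun h => hv (Finset.mem_insert_of_mem h)
    refine ⟨insert w H, v, hcard', hv, fun z hz => ?_, hmax⟩
    rcases Finset.mem_insert.1 hz with rfl | hz
    · exact hvw
    · exact hvw.trans (hge z hz)

/-- The mass of the preimage of a finite set is the sum of the masses of the fibers. -/
theorem sum_filter_mem_eq_sum_fibers {P Z : Type*} [Fintype P] [DecidableEq Z]
    (f : P → Z) (μ : P → ℝ) (H : Finset Z) :
    ∑ p ∈ Finset.univ.filter (fun p => f p ∈ H), μ p =
      ∑ z ∈ H, ∑ p ∈ Finset.univ.filter (fun p => f p = z), μ p := by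
  rw [← Finset.sum_fiberwise_of_maps_to (s := Finset.univ.filter (fun p => f p ∈ H)) (t := H)
    (g := f) (by simp)]
  refine Finset.sum_congr rfl fun z hz => Finset.sum_congr ?_ fun _ _ => rfl
  ext p
  simp only [Finset.mem_filter, Finset.mem_univ, true_and, and_iff_right_iff_imp]
  rintro rfl
  exact hz


/-- **The weak partition bound is at least `ξ^μ_ε(f) − 1`.** For a function
`f : X × Y → Z`, a distribution `μ` on `X × Y` and `0 < ε < 1/2`, there is a feasible
solution `(α, β)` of the weak partition bound linear program whose value
`(1-ε)·α − ∑ β` is at least `ξ^μ_ε(f) − 1`, where `ξ^μ_ε(f)` is the minimum number of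
output values whose preimages carry `μ`-mass at least `1-ε`. -/
theorem weak_partition_bound_ge_xi_sub_one
    {X Y Z : Type*} [Fintype X] [Fintype Y] [Fintype Z]
    [Nonempty X] [Nonempty Y] [Nonempty Z] [DecidableEq Z]
    (f : X × Y → Z) (μ : X × Y → ℝ)
    (hμ0 : ∀ p, 0 ≤ μ p) (hμ1 : ∑ p, μ p = 1)
    (ε : ℝ) (hε0 : 0 < ε) (hε1 : ε < 1 / 2) :
    ∃ (α : ℝ) (β : X × Y → ℝ), 0 ≤ α ∧ (∀ p, 0 ≤ β p) ∧
      (∀ (S : Finset X) (T : Finset Y) (z : Z),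
        α * (∑ p ∈ (S ×ˢ T).filter (fun p => f p = z), μ p) - ∑ p ∈ S ×ˢ T, β p ≤ 1) ∧
      (∀ p : X × Y, 0 ≤ α * μ p - β p) ∧
      (((sInf {k : ℕ | ∃ W : Finset Z, W.card = k ∧
          1 - ε ≤ ∑ p ∈ Finset.univ.filter (fun p : X × Y => f p ∈ W), μ p} : ℕ) : ℝ) - 1
        ≤ (1 - ε) * α - ∑ p, β p) := by
  have hfiber := sum_filter_mem_eq_sum_fibers f μ
  set m : Z → ℝ := fun z => ∑ p ∈ Finset.univ.filter (fun p => f p = z), μ p with hm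
  set K : Set ℕ := {k : ℕ | ∃ W : Finset Z, W.card = k ∧
    1 - ε ≤ ∑ p ∈ Finset.univ.filter (fun p : X × Y => f p ∈ W), μ p} with hK
  have huniv : Fintype.card Z ∈ K := ⟨Finset.univ, rfl, by simp [hμ1, hε0.le]⟩
  have hle : sInf K ≤ Fintype.card Z := Nat.sInf_le huniv
  have hpos : 0 < sInf K := by
    rw [Nat.pos_iff_ne_zero]
    intro h0
    obtain ⟨W, hW, hmass⟩ := h0 ▸ Nat.sInf_mem ⟨_, huniv⟩
    rw [Finset.card_eq_zero.1 hW] at hmass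
    simp only [Finset.notMem_empty, Finset.filter_false, Finset.sum_empty] at hmass
    linarith
  obtain ⟨H, w, hcard, hw, hge, hlew⟩ :=
    exists_heaviest_finset_and_next m (sInf K - 1) (by omega)
  have hmassH : ∑ z ∈ H, m z < 1 - ε := by
    by_contra! hcon
    exact Nat.notMem_of_lt_sInf (show sInf K - 1 < sInf K by omega)
      ⟨H, hcard, by rwa [hfiber]⟩
  have htot : ∑ z, m z = 1 := by
    rw [← hμ1]
    exact Finset.sum_fiberwise _ _ _
  have ht : 0 < m w := by
    by_contra! hcon
    have h1 := Finset.sum_add_sum_compl H m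
    have h2 : ∑ z ∈ Hᶜ, m z ≤ 0 :=
      Finset.sum_nonpos fun z hz => (hlew z (Finset.mem_compl.1 hz)).trans hcon
    linarith
  set c : Z → ℝ := fun z => if z ∈ H then 1 / m w - 1 / m z else 0 with hc
  have hc0 (z : Z) : 0 ≤ c z := by
    simp only [hc]
    split_ifs with hz
    · exact sub_nonneg.2 (one_div_le_one_div_of_le ht (hge z hz))
    · exact le_rfl
  have hc1 (z : Z) : c z ≤ 1 / m w := by
    simp only [hc]
    split_ifs with hz
    · have : 0 < 1 / m z := one_div_pos.2 (ht.trans_le (hge z hz))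
      linarith
    · positivity
  have hcm (z : Z) : (1 / m w - c z) * m z ≤ 1 := by
    simp only [hc]
    split_ifs with hz
    · have : 0 < m z := ht.trans_le (hge z hz)
      rw [sub_sub_cancel, one_div_mul_cancel this.ne']
    · rw [sub_zero, one_div_mul_eq_div, div_le_one ht]
      exact hlew z hz
  refine ⟨1 / m w, fun p => c (f p) * μ p, by positivity,
    fun p => mul_nonneg (hc0 _) (hμ0 p), fun S T z => ?_, fun p => ?_, ?_⟩
  · set A := ∑ p ∈ (S ×ˢ T).filter (fun p => f p = z), μ p with hA
    have h1 : c z * A ≤ ∑ p ∈ S ×ˢ T, c (f p) * μ p := by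
      rw [hA, Finset.mul_sum]
      calc _ = ∑ p ∈ (S ×ˢ T).filter (fun p => f p = z), c (f p) * μ p :=
            Finset.sum_congr rfl fun p hp => by rw [(Finset.mem_filter.1 hp).2]
        _ ≤ _ := Finset.sum_le_sum_of_subset_of_nonneg (Finset.filter_subset _ _)
            fun p _ _ => mul_nonneg (hc0 _) (hμ0 p)
    have h2 : A ≤ m z := Finset.sum_le_sum_of_subset_of_nonneg
      (Finset.filter_subset_filter _ (Finset.subset_univ _)) fun p _ _ => hμ0 p
    have h3 := mul_le_mul_of_nonneg_left h2 (sub_nonneg.2 (hc1 z))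
    linarith [hcm z]
  · rw [← sub_mul]
    exact mul_nonneg (sub_nonneg.2 (hc1 _)) (hμ0 p)
  · have hβ : ∑ p, c (f p) * μ p = 1 / m w * ∑ z ∈ H, m z - H.card := by
      calc ∑ p, c (f p) * μ p = ∑ z, c z * m z := by
            rw [← Finset.sum_fiberwise Finset.univ f]
            refine Finset.sum_congr rfl fun z _ => ?_
            rw [hm, Finset.mul_sum]
            exact Finset.sum_congr rfl fun p hp => by rw [(Finset.mem_filter.1 hp).2]
        _ = ∑ z ∈ H, (1 / m w * m z - 1) := by
            simp only [hc, ite_mul, zero_mul, Finset.sum_ite_mem, Finset.univ_inter]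
            refine Finset.sum_congr rfl fun z hz => ?_
            rw [sub_mul, one_div_mul_cancel (ht.trans_le (hge z hz)).ne']
        _ = _ := by simp [Finset.mul_sum]
    have h1 : (H.card : ℝ) = (sInf K : ℕ) - 1 := by
      rw [hcard, Nat.cast_sub hpos, Nat.cast_one]
    have h2 : 1 / m w * ∑ z ∈ H, m z ≤ 1 / m w * (1 - ε) :=
      mul_le_mul_of_nonneg_left hmassH.le (by positivity)
    rw [hβ, h1]
    linarith
end

section
/- Let k be a natural number and let M be the 2^k × 2^k real matrix indexed by pairs of bit strings x, y ∈ {0,1}^k whose (x,y) entry is the numerical value of the bitwise XOR of x and y, i.e., M(x,y) = Σ_{i=0}^{k−1} 2^i · (x_i ⊕ y_i) ∈ ℝ. Then the rank of M over ℝ is at most k + 1. -/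
/-- The sign `(-1) ^ b` of a bit, as a real number. -/
def bitSign (b : Bool) : ℝ := if b then -1 else 1

theorem ite_ne_eq_bitSign (a b : Bool) :
    (if a ≠ b then 1 else 0 : ℝ) = 1 / 2 - bitSign a * bitSign b / 2 := by
  cases a <;> cases b <;> norm_num [bitSign]

/-- A weighted Hamming distance matrix on bit strings of length `k` factors through a space of
dimension `k + 1`. -/
theorem weighted_hamming_matrix_eq_mul {k : ℕ} (w : Fin k → ℝ) :
    Matrix.of (fun x y : Fin k → Bool => ∑ i, w i * (if x i ≠ y i then 1 else 0)) =
      Matrix.of (fun (x : Fin k → Bool) (o : Option (Fin k)) =>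
        o.elim 1 fun i => bitSign (x i)) *
      Matrix.of (fun (o : Option (Fin k)) (y : Fin k → Bool) =>
        o.elim (∑ i, w i / 2) fun i => -(w i * bitSign (y i) / 2)) := by
  ext x y
  simp only [Matrix.of_apply, Matrix.mul_apply, Fintype.sum_option, Option.elim_none,
    Option.elim_some, ite_ne_eq_bitSign, one_mul, ← Finset.sum_add_distrib]
  exact Finset.sum_congr rfl fun i _ => by ring

/-- The `2^k × 2^k` real matrix indexed by bit strings `x, y ∈ {0,1}^k` whose `(x,y)` entry is
the numerical value `∑ i, 2^i * (x i ⊕ y i)` of the bitwise XOR of `x` and `y` has rank at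
most `k + 1` over `ℝ`. -/
theorem rank_xor_matrix_le
    (k : ℕ) :
    Matrix.rank (Matrix.of (fun x y : Fin k → Bool =>
      ∑ i : Fin k, (2 : ℝ) ^ (i : ℕ) * (if x i ≠ y i then 1 else 0))) ≤ k + 1 := by
  rw [weighted_hamming_matrix_eq_mul fun i : Fin k => (2 : ℝ) ^ (i : ℕ)]
  refine (Matrix.rank_mul_le_left _ _).trans ((Matrix.rank_le_card_width _).trans ?_)
  simp
end

section
/- Let n ≥ 1 and let x, y ∈ {0,1}^n with x ≠ y. For a string w ∈ {0,1}^n, define its padded sorted position list ℓ_w : {1,…,n} → {0,1,…,n} by letting ℓ_w(j) be the j-th smallest index i ∈ {0,…,n−1} with w_i = 1 if w has at least j ones, and ℓ_w(j) = n otherwise. Let j* be the smallest index j with ℓ_x(j) ≠ ℓ_y(j) (which exists since x ≠ y). Then min(ℓ_x(j*), ℓ_y(j*)) = min{ i : x_i ≠ y_i }, i.e., the smaller of the two list entries at the first position where the padded sorted lists differ equals the index of the first difference between x and y. -/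
/-- The padded sorted position list of a bit string `w ∈ {0,1}^n`: `padList n w j` is the
`j`-th smallest (0-indexed) position `i` with `w i = 1` if `w` has more than `j` ones,
and the sentinel value `n` otherwise. -/
def padList (n : ℕ) (w : Fin n → Bool) (j : ℕ) : ℕ :=
  ((((List.finRange n).filter (fun i => w i = true)).map Fin.val)).getD j n

/-- The head of a filtered list of positions, with default `n`, exceeds every strict lower bound
of the list. -/
theorem lt_getD_zero_filter {n : ℕ} (q : Fin n → Bool) (l : List (Fin n)) (a : Fin n)
    (h : ∀ b ∈ l, a < b) :
    (a : ℕ) < ((l.filter (fun i => q i = true)).map Fin.val).getD 0 n := by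
  cases hl : l.filter (fun i => q i = true) with
  | nil => simp
  | cons b t =>
    have hb : b ∈ l := List.mem_of_mem_filter (hl ▸ List.mem_cons_self)
    simpa using h b hb

/-- The first disagreement between the padded lists of positions selected by `x` and `y` from a
sorted list `l` reveals the first element of `l` on which `x` and `y` disagree. -/
theorem exists_first_getD_filter_ne {n : ℕ} (x y : Fin n → Bool) (l : List (Fin n))
    (hl : l.Pairwise (· < ·)) (hne : ∃ i ∈ l, x i ≠ y i) :
    ∃ j < l.length,
      ((l.filter (fun i => x i = true)).map Fin.val).getD j n ≠
        ((l.filter (fun i => y i = true)).map Fin.val).getD j n ∧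
      (∀ k < j, ((l.filter (fun i => x i = true)).map Fin.val).getD k n =
        ((l.filter (fun i => y i = true)).map Fin.val).getD k n) ∧
      ∃ i ∈ l, x i ≠ y i ∧ (∀ k ∈ l, x k ≠ y k → i ≤ k) ∧
        min (((l.filter (fun i => x i = true)).map Fin.val).getD j n)
          (((l.filter (fun i => y i = true)).map Fin.val).getD j n) = i := by
  induction l with
  | nil => simp at hne
  | cons a l ih =>
    obtain ⟨ha, hl⟩ := List.pairwise_cons.1 hl
    by_cases hxy : x a = y a
    · have hne' : ∃ i ∈ l, x i ≠ y i := by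
        obtain ⟨i, hi, hi'⟩ := hne
        rcases List.mem_cons.1 hi with rfl | hi
        · exact absurd hxy hi'
        · exact ⟨i, hi, hi'⟩
      obtain ⟨j, hj, hjne, hjlt, i, hi, hine, himin, hmin⟩ := ih hl hne'
      have himin' : ∀ k ∈ a :: l, x k ≠ y k → i ≤ k := by
        intro k hk hk'
        rcases List.mem_cons.1 hk with rfl | hk
        · exact absurd hxy hk'
        · exact himin k hk hk'
      cases hx : x a with
      | false =>
        have hy : y a = false := hxy ▸ hx
        rw [List.filter_cons_of_neg (by simp [hx]), List.filter_cons_of_neg (by simp [hy])]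
        exact ⟨j, Nat.lt_succ_of_lt hj, hjne, hjlt, i, List.mem_cons_of_mem _ hi, hine, himin',
          hmin⟩
      | true =>
        have hy : y a = true := hxy ▸ hx
        rw [List.filter_cons_of_pos (by simp [hx]), List.filter_cons_of_pos (by simp [hy])]
        simp only [List.map_cons]
        refine ⟨j + 1, Nat.succ_lt_succ hj, ?_, ?_, i, List.mem_cons_of_mem _ hi, hine, himin', ?_⟩
        · simpa only [List.getD_cons_succ] using hjne
        · rintro (_ | k) hk
          · simp only [List.getD_cons_zero]
          · simpa only [List.getD_cons_succ] using hjlt k (Nat.lt_of_succ_lt_succ hk)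
        · simpa only [List.getD_cons_succ] using hmin
    · have hamin : ∀ k ∈ a :: l, x k ≠ y k → a ≤ k := by
        intro k hk _
        rcases List.mem_cons.1 hk with rfl | hk
        · exact le_rfl
        · exact (ha k hk).le
      refine ⟨0, Nat.succ_pos _, ?_⟩
      cases hx : x a with
      | false =>
        have hy : y a = true := by simpa [hx] using hxy
        have hlt := lt_getD_zero_filter x l a ha
        rw [List.filter_cons_of_neg (by simp [hx]), List.filter_cons_of_pos (by simp [hy])]
        simp only [List.map_cons, List.getD_cons_zero]
        exact ⟨hlt.ne', by simp, a, List.mem_cons_self, hxy, hamin, min_eq_right hlt.le⟩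
      | true =>
        have hy : y a = false := by simpa [hx] using hxy
        have hlt := lt_getD_zero_filter y l a ha
        rw [List.filter_cons_of_pos (by simp [hx]), List.filter_cons_of_neg (by simp [hy])]
        simp only [List.map_cons, List.getD_cons_zero]
        exact ⟨hlt.ne, by simp, a, List.mem_cons_self, hxy, hamin, min_eq_left hlt.le⟩

/-- **Find the First Difference via sorted position lists.** For distinct `x, y ∈ {0,1}^n`,
the padded sorted position lists of `x` and `y` differ at some first position `j*`, and the
smaller of the two list entries at `j*` equals the index of the first difference between
`x` and `y`. -/
theorem min_padList_firstDiff_eq_firstDiff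
    (n : ℕ) (hn : 1 ≤ n) (x y : Fin n → Bool) (hxy : x ≠ y) :
    ∃ jstar : ℕ, jstar < n ∧
      padList n x jstar ≠ padList n y jstar ∧
      (∀ j < jstar, padList n x j = padList n y j) ∧
      min (padList n x jstar) (padList n y jstar)
        = sInf {i : ℕ | ∃ h : i < n, x ⟨i, h⟩ ≠ y ⟨i, h⟩} := by
  obtain ⟨j, hj, hjne, hjlt, i, -, hine, himin, hmin⟩ :=
    exists_first_getD_filter_ne x y (List.finRange n) (List.pairwise_lt_finRange n)
      (by simpa using Function.ne_iff.1 hxy)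
  refine ⟨j, by simpa using hj, hjne, hjlt, hmin.trans ?_⟩
  have hleast : IsLeast {i : ℕ | ∃ h : i < n, x ⟨i, h⟩ ≠ y ⟨i, h⟩} (i : ℕ) :=
    ⟨⟨i.isLt, hine⟩, fun k ⟨hk, hk'⟩ => himin ⟨k, hk⟩ (List.mem_finRange _) hk'⟩
  exact hleast.csInf_eq.symm
end
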